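/- Let T be an automorphism of a measurable space (X, 𝓕) and let μ₀ be a T-invariant probability measure on (X, 𝓕). Let ξ be a countable measurable partition of (X, 𝓕) with finite entropy H_{μ₀}(ξ) < ∞. Suppose there exist a sequence (μₙ)_{n≥1} of T-invariant probability measures, a sequence of natural numbers rₙ, and a sequence of positive reals εₙ such that: (i) rₙ → ∞, εₙ → 0, and limsup_{n→∞} h_{μₙ}(T) ≥ h for some h ≥ 0; (ii) ξ is a generator for (T, μₙ) for every n ≥ 0; (iii) |μ₀(A) − μₙ(A)| ≤ εₙ μₙ(A) for every atom A of the partition ⋁_{i=0}^{rₙ} T^{-i} ξ and every n ≥ 0. Then the Kolmogorov–Sinai entropy satisfies h_{μ₀}(T) ≥ h. -/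

import Mathlib

open MeasureTheory Filter Set
open scoped ENNReal

/-- A countable measurable partition of `X`, encoded as an `ℕ`-indexed family of
pairwise disjoint measurable sets covering `X` (atoms are allowed to be empty,
which accommodates finite partitions as well). -/
def IsCountablePartition {X : Type*} [MeasurableSpace X] (η : ℕ → Set X) : Prop :=
  (∀ i, MeasurableSet (η i)) ∧ Pairwise (Function.onFun Disjoint η) ∧ (⋃ i, η i) = Set.univ

/-- The entropy `H_μ(η) = -∑_A μ(A) log μ(A)` of a countable family of sets,
computed in `ℝ≥0∞` since it may be infinite (`0 log 0 = 0` by convention). -/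
noncomputable def partEntropy {X ι : Type*} [MeasurableSpace X]
    (μ : Measure X) (η : ι → Set X) : ℝ≥0∞ :=
  ∑' i, ENNReal.ofReal (Real.negMulLog (μ (η i)).toReal)

/-- The atom of the refinement `⋁_{i=k}^{k+r-1} T⁻ⁱ ξ` labelled by the word
`f : Fin r → ℕ`, namely `⋂_j T^{-(k+j)} ξ_{f j}`. -/
def joinAtom {X : Type*} (T : X → X) (ξ : ℕ → Set X) (k r : ℕ) (f : Fin r → ℕ) : Set X :=
  ⋂ j : Fin r, (T^[k + (j : ℕ)]) ⁻¹' (ξ (f j))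

/-- The entropy of `T` relative to the partition `ξ`:
`h_μ(T, ξ) = lim_n (1/n) H_μ(⋁_{i=1}^n T⁻ⁱ ξ)` (formalized via `liminf`). -/
noncomputable def entropyOf {X : Type*} [MeasurableSpace X]
    (T : X → X) (μ : Measure X) (ξ : ℕ → Set X) : ℝ≥0∞ :=
  Filter.atTop.liminf (fun n : ℕ => partEntropy μ (joinAtom T ξ 1 n) / (n : ℝ≥0∞))

/-- Kolmogorov–Sinai entropy: the supremum of `h_μ(T, η)` over all countable
measurable partitions `η` of finite entropy. -/
noncomputable def ksEntropy {X : Type*} [MeasurableSpace X]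
    (T : X → X) (μ : Measure X) : ℝ≥0∞ :=
  ⨆ (η : ℕ → Set X) (_ : IsCountablePartition η) (_ : partEntropy μ η ≠ ⊤),
    entropyOf T μ η

/-- `ξ` is a generator for `(T, μ)`: the σ-algebra generated by
`{T^{-i} ξ_j : i ∈ ℤ, j ∈ ℕ}` equals the full σ-algebra modulo `μ`-null sets. -/
def IsGenerator {X : Type*} [MeasurableSpace X]
    (T : X ≃ᵐ X) (μ : Measure X) (ξ : ℕ → Set X) : Prop :=
  ∀ A : Set X, MeasurableSet A → ∃ B : Set X,
    MeasurableSet[MeasurableSpace.generateFrom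
      {S : Set X | ∃ (i : ℤ) (j : ℕ), S = ⇑(T.toEquiv ^ i) ⁻¹' (ξ j)}] B ∧
    μ (symmDiff A B) = 0

section Helpers

variable {X : Type*} [MeasurableSpace X]

noncomputable def Hf {S : Type*} (μ : Measure X) (f : X → S) : ℝ≥0∞ :=
  partEntropy μ (fun s => f ⁻¹' {s})

noncomputable def Linfo (p : ℝ≥0∞) : ℝ≥0∞ := ENNReal.ofReal (-Real.log p.toReal)

lemma Linfo_anti {p q : ℝ≥0∞} (h0 : p ≠ 0) (hpq : p ≤ q) (hq : q ≠ ⊤) : Linfo q ≤ Linfo p := by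
  apply ENNReal.ofReal_le_ofReal
  have hp : p ≠ ⊤ := ne_top_of_le_ne_top hq hpq
  have := Real.log_le_log (ENNReal.toReal_pos h0 hp) (ENNReal.toReal_mono hq hpq)
  linarith

section
variable {S : Type*} [Countable S] [MeasurableSpace S] [MeasurableSingletonClass S]
variable {S' : Type*} [Countable S'] [MeasurableSpace S'] [MeasurableSingletonClass S']
variable {S'' : Type*} [Countable S''] [MeasurableSpace S''] [MeasurableSingletonClass S'']

lemma lint_fib (μ : Measure X) {f : X → S} (hf : Measurable f) (F : S → ℝ≥0∞) :
    ∫⁻ x, F (f x) ∂μ = ∑' s, F s * μ (f ⁻¹' {s}) := by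
  rw [← lintegral_map (measurable_of_countable F) hf, lintegral_countable']
  congr 1 with s
  rw [Measure.map_apply hf (measurableSet_singleton s)]

lemma Hf_eq (μ : Measure X) [IsProbabilityMeasure μ] {f : X → S} (hf : Measurable f) :
    Hf μ f = ∫⁻ x, Linfo (μ (f ⁻¹' {f x})) ∂μ := by
  rw [lint_fib μ hf (fun s => Linfo (μ (f ⁻¹' {s})))]
  unfold Hf partEntropy Linfo
  congr 1 with s
  have hne : μ (f ⁻¹' {s}) ≠ ⊤ := measure_ne_top _ _
  conv_rhs => rw [← ENNReal.ofReal_toReal hne]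
  rw [ENNReal.toReal_ofReal ENNReal.toReal_nonneg, ← ENNReal.ofReal_mul' ENNReal.toReal_nonneg,
    Real.negMulLog]
  congr 1; ring

lemma ae_fib (μ : Measure X) {f : X → S} (hf : Measurable f) :
    ∀ᵐ x ∂μ, μ (f ⁻¹' {f x}) ≠ 0 := by
  have : {x | ¬ μ (f ⁻¹' {f x}) ≠ 0} = f ⁻¹' {s | μ (f ⁻¹' {s}) = 0} := by
    ext x; simp
  rw [ae_iff, this, measure_preimage_eq_zero_iff_of_countable (to_countable _)]
  intro x hx; exact hx

lemma Hf_comp_le (μ : Measure X) [IsProbabilityMeasure μ] {g : X → S} (hg : Measurable g)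
    (u : S → S') : Hf μ (fun x => u (g x)) ≤ Hf μ g := by
  have hug : Measurable (fun x => u (g x)) := (measurable_of_countable u).comp hg
  rw [Hf_eq μ hg, Hf_eq μ hug]
  apply lintegral_mono_ae
  filter_upwards [ae_fib μ hg] with x hx
  refine Linfo_anti hx (measure_mono ?_) (measure_ne_top _ _)
  intro y hy
  simp only [mem_preimage, mem_singleton_iff] at hy ⊢
  rw [hy]

lemma tsum_fib (μ : Measure X) {f : X → S} (hf : Measurable f) (A : Set X) :
    ∑' s, μ (f ⁻¹' {s} ∩ A) = μ A := by
  have := lint_fib (μ.restrict A) hf (fun _ => 1)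
  simp only [lintegral_const, one_mul, Measure.restrict_apply MeasurableSet.univ, univ_inter] at this
  rw [this]
  congr 1 with s
  rw [Measure.restrict_apply (hf (measurableSet_singleton s))]

/-- pointwise Gibbs inequality -/
lemma gibbs_pt {p x y z : ℝ≥0∞} (hp : p ≠ 0) (hpx : p ≤ x) (hpy : p ≤ y) (hxz : x ≤ z)
    (hyz : y ≤ z) (hz : z ≤ 1) :
    Linfo p + Linfo z + 1 ≤ Linfo x + Linfo y + (x * y / z) / p := by
  have hzt : z ≠ ⊤ := ne_top_of_le_ne_top ENNReal.one_ne_top hz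
  have hxt : x ≠ ⊤ := ne_top_of_le_ne_top hzt hxz
  have hyt : y ≠ ⊤ := ne_top_of_le_ne_top hzt hyz
  have hpt : p ≠ ⊤ := ne_top_of_le_ne_top hxt hpx
  lift p to NNReal using hpt
  lift x to NNReal using hxt
  lift y to NNReal using hyt
  lift z to NNReal using hzt
  norm_cast at *
  have p0 : 0 < (p : ℝ) := by positivity
  have hpx' : (p : ℝ) ≤ x := by exact_mod_cast hpx
  have hpy' : (p : ℝ) ≤ y := by exact_mod_cast hpy
  have hxz' : (x : ℝ) ≤ z := by exact_mod_cast hxz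
  have hyz' : (y : ℝ) ≤ z := by exact_mod_cast hyz
  have hz' : (z : ℝ) ≤ 1 := by exact_mod_cast hz
  have x0 : 0 < (x : ℝ) := by linarith
  have y0 : 0 < (y : ℝ) := by linarith
  have z0 : 0 < (z : ℝ) := by linarith
  have hz0 : z ≠ 0 := by intro h; simp [h] at z0
  have hlog : ∀ t : ℝ, 0 < t → t ≤ 1 → 0 ≤ - Real.log t := fun t h1 h2 => by
    have := Real.log_nonpos h1.le h2; linarith
  have e : ((x * y : NNReal) : ℝ≥0∞) / z / p = ENNReal.ofReal ((x:ℝ) * y / z / p) := by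
    rw [← ENNReal.coe_div hz0, ← ENNReal.coe_div hp, ENNReal.ofReal]
    congr 1
    apply NNReal.eq
    rw [Real.coe_toNNReal _ (by positivity)]
    simp
  have e1 : (1 : ℝ≥0∞) = ENNReal.ofReal 1 := by simp
  have l1 := hlog p p0 (by linarith)
  have l2 := hlog x x0 (by linarith)
  have l3 := hlog y y0 (by linarith)
  have l4 := hlog z z0 (by linarith)
  have q0 : 0 < (x:ℝ) * y / z / p := by positivity
  rw [e, e1]
  simp only [Linfo, ENNReal.coe_toReal]
  rw [← ENNReal.ofReal_add l1 l4, ← ENNReal.ofReal_add (by linarith) (by norm_num),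
    ← ENNReal.ofReal_add l2 l3, ← ENNReal.ofReal_add (by linarith) q0.le]
  apply ENNReal.ofReal_le_ofReal
  have := Real.log_le_sub_one_of_pos q0
  rw [Real.log_div (by positivity) (by positivity), Real.log_div (by positivity) (by positivity),
    Real.log_mul (by positivity) (by positivity)] at this
  linarith

lemma Hf_submod (μ : Measure X) [IsProbabilityMeasure μ] {a : X → S} {b : X → S'} {c : X → S''}
    (ha : Measurable a) (hb : Measurable b) (hc : Measurable c) :
    Hf μ (fun x => (a x, b x, c x)) + Hf μ c
      ≤ Hf μ (fun x => (a x, c x)) + Hf μ (fun x => (b x, c x)) := by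
  have habc : Measurable (fun x => (a x, b x, c x)) := ha.prodMk (hb.prodMk hc)
  have hac : Measurable (fun x => (a x, c x)) := ha.prodMk hc
  have hbc : Measurable (fun x => (b x, c x)) := hb.prodMk hc
  set P : S × S' × S'' → ℝ≥0∞ := fun s => μ ((fun x => (a x, b x, c x)) ⁻¹' {s}) with hP
  set A : S × S'' → ℝ≥0∞ := fun s => μ ((fun x => (a x, c x)) ⁻¹' {s}) with hA
  set B : S' × S'' → ℝ≥0∞ := fun s => μ ((fun x => (b x, c x)) ⁻¹' {s}) with hB
  set C : S'' → ℝ≥0∞ := fun s => μ (c ⁻¹' {s}) with hC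
  have mm : ∀ F : S × S' × S'' → ℝ≥0∞, Measurable (fun x => F (a x, b x, c x)) := fun F =>
    (measurable_of_countable F).comp habc
  have sA : ∀ s, ∑' i, A (i, s) = C s := by
    intro s
    rw [hC]; simp only
    rw [← tsum_fib μ ha]
    congr 1 with i
    simp only [hA]; congr 1; ext x; simp
  have sB : ∀ s, ∑' i, B (i, s) = C s := by
    intro s
    rw [hC]; simp only
    rw [← tsum_fib μ hb]
    congr 1 with i
    simp only [hB]; congr 1; ext x; simp
  have sC : ∑' s, C s = 1 := by
    have := tsum_fib μ hc univ
    simpa using this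
  set Q : S × S' × S'' → ℝ≥0∞ := fun s => A (s.1, s.2.2) * B (s.2.1, s.2.2) / C s.2.2 with hQ
  have sQ : ∑' s, Q s ≤ 1 := by
    rw [ENNReal.tsum_prod', ENNReal.tsum_comm]
    rw [ENNReal.tsum_prod', ENNReal.tsum_comm]
    rw [← sC]
    refine ENNReal.tsum_le_tsum fun s => ?_
    simp only [hQ, div_eq_mul_inv]
    simp_rw [ENNReal.tsum_mul_right, sA, ENNReal.tsum_mul_left, sB, mul_assoc]
    calc C s * (C s * (C s)⁻¹) ≤ C s * 1 := by gcongr; exact ENNReal.mul_inv_le_one _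
      _ = C s := mul_one _
  have i1 : ∫⁻ x, (Q (a x, b x, c x) / P (a x, b x, c x)) ∂μ ≤ 1 := by
    have := lint_fib μ habc (fun s => Q s / P s)
    rw [this]
    refine le_trans (ENNReal.tsum_le_tsum fun s => ?_) sQ
    change Q s / P s * P s ≤ Q s
    rw [div_eq_mul_inv, mul_assoc, mul_comm (P s)⁻¹]
    calc Q s * (P s * (P s)⁻¹) ≤ Q s * 1 := by gcongr; exact ENNReal.mul_inv_le_one _
      _ = Q s := mul_one _
  have key : Hf μ (fun x => (a x, b x, c x)) + Hf μ c + 1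
      ≤ Hf μ (fun x => (a x, c x)) + Hf μ (fun x => (b x, c x)) + 1 := by
    refine le_trans ?_ (add_le_add_right i1 _)
    rw [Hf_eq μ habc, Hf_eq μ hc, Hf_eq μ hac, Hf_eq μ hbc]
    have m1 := mm (fun s => Linfo (P s))
    have m2 := mm (fun s => Linfo (C s.2.2))
    have m3 := mm (fun s => Linfo (A (s.1, s.2.2)))
    have m4 := mm (fun s => Linfo (B (s.2.1, s.2.2)))
    have m5 := mm (fun s => Q s / P s)
    have e1 : (1 : ℝ≥0∞) = ∫⁻ _, 1 ∂μ := by simp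
    rw [e1, ← lintegral_add_left m1, ← lintegral_add_right _ measurable_const,
      ← lintegral_add_left m3, ← lintegral_add_right _ m5]
    apply lintegral_mono_ae
    filter_upwards [ae_fib μ habc] with x hx
    refine gibbs_pt hx ?_ ?_ ?_ ?_ prob_le_one <;>
    · apply measure_mono
      intro y
      simp only [mem_preimage, mem_singleton_iff, Prod.mk.injEq]
      tauto
  exact (ENNReal.add_le_add_iff_right ENNReal.one_ne_top).1 key

lemma Hf_comp_eq (μ : Measure X) {Y : X → X} (hY : MeasurePreserving Y μ μ) {f : X → S}
    (hf : Measurable f) : Hf μ (fun x => f (Y x)) = Hf μ f := by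
  unfold Hf partEntropy
  congr 1 with s
  have := hY.measure_preimage (hf (measurableSet_singleton s)).nullMeasurableSet
  rw [← this]; rfl

lemma Hf_const (μ : Measure X) [IsProbabilityMeasure μ] (s : S) : Hf μ (fun _ : X => s) = 0 := by
  rw [Hf_eq μ measurable_const]
  simp [Linfo]

lemma Hf_pair_le (μ : Measure X) [IsProbabilityMeasure μ] {a : X → S} {b : X → S'}
    (ha : Measurable a) (hb : Measurable b) :
    Hf μ (fun x => (a x, b x)) ≤ Hf μ a + Hf μ b := by
  have h := Hf_submod μ ha hb (measurable_const (a := ()))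
  rw [Hf_const, add_zero] at h
  have h1 := Hf_comp_le μ (ha.prodMk (hb.prodMk (measurable_const (a := ()))))
    (fun s => (s.1, s.2.1))
  have h2 := Hf_comp_le μ ha (fun s => (s, ()))
  have h3 := Hf_comp_le μ hb (fun s => (s, ()))
  exact h1.trans (h.trans (add_le_add h2 h3))

/-- conditioning on more decreases the excess -/
lemma Hf_cond_mono (μ : Measure X) [IsProbabilityMeasure μ] {a : X → S} {k : X → S'}
    (ha : Measurable a) (hk : Measurable k) (u : S' → S'') {d : ℝ≥0∞}
    (hfin : Hf μ k ≠ ⊤)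
    (h : Hf μ (fun x => (a x, u (k x))) ≤ Hf μ (fun x => u (k x)) + d) :
    Hf μ (fun x => (a x, k x)) ≤ Hf μ k + d := by
  have hu : Measurable (fun x => u (k x)) := (measurable_of_countable u).comp hk
  have h1 := Hf_submod μ ha hk hu
  have h2 := Hf_comp_le μ (ha.prodMk (hk.prodMk hu)) (fun s => (s.1, s.2.1))
  have h3 := Hf_comp_le μ hk (fun s => (s, u s))
  have hfu : Hf μ (fun x => u (k x)) ≠ ⊤ := ne_top_of_le_ne_top hfin (Hf_comp_le μ hk u)
  simp only at h2
  rw [← ENNReal.add_le_add_iff_right hfu]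
  calc _ ≤ _ := add_le_add_left h2 _
    _ ≤ _ := h1
    _ ≤ _ := add_le_add h h3
    _ = _ := by ring

end

/-- the itinerary of length `n` -/
def itin (T : X → X) (g : X → ℕ) (n : ℕ) (x : X) : Fin n → ℕ := fun j => g (T^[(j : ℕ)] x)

lemma itin_meas {T : X → X} (hT : Measurable T) {g : X → ℕ} (hg : Measurable g) (n : ℕ) :
    Measurable (itin T g n) :=
  measurable_pi_lambda _ fun j => hg.comp (hT.iterate j)

lemma Hf_itin_mono (μ : Measure X) [IsProbabilityMeasure μ] {T : X → X} (hT : Measurable T)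
    {g : X → ℕ} (hg : Measurable g) {a b : ℕ} (hab : a ≤ b) :
    Hf μ (itin T g a) ≤ Hf μ (itin T g b) :=
  Hf_comp_le μ (itin_meas hT hg b) (fun w (j : Fin a) => w (Fin.castLE hab j))

lemma Hf_itin_add (μ : Measure X) [IsProbabilityMeasure μ] {T : X → X}
    (hT : MeasurePreserving T μ μ)
    {g : X → ℕ} (hg : Measurable g) (a b : ℕ) :
    Hf μ (itin T g (a + b)) ≤ Hf μ (itin T g a) + Hf μ (itin T g b) := by
  have ma := itin_meas hT.measurable hg a
  have mb := itin_meas hT.measurable hg b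
  have mb' : Measurable (fun x => itin T g b (T^[a] x)) := mb.comp (hT.measurable.iterate a)
  have h1 := Hf_pair_le μ ma mb'
  rw [Hf_comp_eq μ (hT.iterate a) mb] at h1
  refine le_trans ?_ h1
  have h2 := Hf_comp_le μ (ma.prodMk mb') (fun w => Fin.append w.1 w.2)
  refine le_trans (le_of_eq ?_) h2
  congr 1
  funext x j
  refine Fin.addCases (fun i => ?_) (fun i => ?_) j
  · simp [itin]
  · simp [itin, ← Function.iterate_add_apply, add_comm]

lemma Hf_itin_zero (μ : Measure X) [IsProbabilityMeasure μ] (T : X → X) (g : X → ℕ) :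
    Hf μ (itin T g 0) = 0 := by
  have : itin T g 0 = fun _ => Fin.elim0 := by
    funext x j; exact j.elim0
  rw [this, Hf_const]

lemma Hf_itin_mul (μ : Measure X) [IsProbabilityMeasure μ] {T : X → X}
    (hT : MeasurePreserving T μ μ)
    {g : X → ℕ} (hg : Measurable g) (m k : ℕ) :
    Hf μ (itin T g (k * m)) ≤ k * Hf μ (itin T g m) := by
  induction k with
  | zero => rw [Nat.zero_mul, Hf_itin_zero]; simp
  | succ k ih =>
    rw [Nat.succ_mul]
    refine (Hf_itin_add μ hT hg _ _).trans ?_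
    push_cast
    rw [add_mul, one_mul]
    gcongr

lemma Hf_itin_one (μ : Measure X) [IsProbabilityMeasure μ] {T : X → X}
    {g : X → ℕ} (hg : Measurable g) :
    Hf μ (itin T g 1) ≤ Hf μ g := by
  have := Hf_comp_le μ hg (fun s (_ : Fin 1) => s)
  refine le_trans (le_of_eq ?_) this
  congr 1
  funext x j
  simp [itin]

lemma Hf_itin_one' (μ : Measure X) [IsProbabilityMeasure μ] {T : X → X} (hT : Measurable T)
    {g : X → ℕ} (hg : Measurable g) :
    Hf μ g ≤ Hf μ (itin T g 1) :=
  Hf_comp_le μ (itin_meas hT hg 1) (fun s => s 0)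

lemma Hf_itin_fin (μ : Measure X) [IsProbabilityMeasure μ] {T : X → X}
    (hT : MeasurePreserving T μ μ)
    {g : X → ℕ} (hg : Measurable g) (hfin : Hf μ g ≠ ⊤) (n : ℕ) : Hf μ (itin T g n) ≠ ⊤ := by
  have := Hf_itin_mul μ hT hg 1 n
  rw [mul_one] at this
  refine ne_top_of_le_ne_top (ENNReal.mul_ne_top (ENNReal.natCast_ne_top n) ?_) this
  exact ne_top_of_le_ne_top hfin (Hf_itin_one μ hg)

lemma Hf_itin_bound (μ : Measure X) [IsProbabilityMeasure μ] {T : X → X}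
    (hT : MeasurePreserving T μ μ)
    {g : X → ℕ} (hg : Measurable g) (m M : ℕ) (hm : 0 < m) :
    Hf μ (itin T g M) ≤ ENNReal.ofReal ((M : ℝ) / m + 1) * Hf μ (itin T g m) := by
  have h1 : M ≤ (M / m + 1) * m := by
    have := Nat.lt_div_mul_add (a := M) hm
    rw [add_mul, one_mul]; omega
  refine (Hf_itin_mono μ hT.measurable hg h1).trans ((Hf_itin_mul μ hT hg m _).trans ?_)
  gcongr
  rw [← ENNReal.ofReal_natCast]
  apply ENNReal.ofReal_le_ofReal
  push_cast
  gcongr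
  exact Nat.cast_div_le

/-- Inductive step for the generator theorem. -/
lemma Hf_joint_bound (μ : Measure X) [IsProbabilityMeasure μ] {T : X → X}
    (hT : MeasurePreserving T μ μ) {f g : X → ℕ} (hf : Measurable f) (hg : Measurable g)
    (hfin : Hf μ g ≠ ⊤) (N K : ℕ) (d : ℝ≥0∞)
    (h : Hf μ (fun x => (f (T^[N] x), itin T g K x)) ≤ Hf μ (itin T g K) + d) (n : ℕ) :
    Hf μ (fun x => (itin T f n (T^[N] x), itin T g (n + K) x)) ≤ Hf μ (itin T g (n + K)) + n * d := by
  have hTm := hT.measurable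
  have mF : ∀ n, Measurable (fun x => itin T f n (T^[N] x)) := fun n =>
    (itin_meas hTm hf n).comp (hTm.iterate N)
  have mf : ∀ n, Measurable (fun x => f (T^[n] x)) := fun n => hf.comp (hTm.iterate n)
  have mg : ∀ n, Measurable (itin T g n) := itin_meas hTm hg
  induction n with
  | zero =>
    have := Hf_comp_le μ (mg (0 + K)) (fun w => ((fun j => j.elim0 : Fin 0 → ℕ), w))
    refine le_trans (le_of_eq ?_) (this.trans (by simp))
    congr 1
    funext x
    congr 1
    funext j; exact j.elim0
  | succ n ih =>
    have hG := Hf_itin_fin μ hT hg hfin (n + 1 + K)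
    -- first
    have h1 : Hf μ (fun x => (itin T f n (T^[N] x), itin T g (n + 1 + K) x))
        ≤ Hf μ (itin T g (n + 1 + K)) + n * d :=
      Hf_cond_mono μ (mF n) (mg (n + 1 + K))
        (fun w (j : Fin (n + K)) => w (Fin.castLE (by omega) j)) hG ih
    have h2 : Hf μ (fun x => (f (T^[N + n] x), itin T g (n + 1 + K) x))
        ≤ Hf μ (itin T g (n + 1 + K)) + d := by
      refine Hf_cond_mono μ (mf (N + n)) (mg (n + 1 + K))
        (fun w (j : Fin K) => w ⟨n + j, by omega⟩) hG ?_
      have e1 := Hf_comp_eq μ (hT.iterate n) ((mf N).prodMk (mg K))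
      have e2 := Hf_comp_eq μ (hT.iterate n) (mg K)
      rw [← e1, ← e2] at h
      have e3 : ∀ x, (fun j : Fin K => itin T g (n + 1 + K) x ⟨n + j, by omega⟩)
          = itin T g K (T^[n] x) := by
        intro x
        funext j
        simp only [itin]
        rw [← Function.iterate_add_apply, add_comm]
      have e4 : (fun x (j : Fin K) => itin T g (n + 1 + K) x ⟨n + j, by omega⟩)
          = fun x => itin T g K (T^[n] x) := funext e3
      rw [e4]
      simp only [e3, Function.iterate_add_apply]
      exact h
    have h3 := Hf_submod μ (mF n) (mf (N + n)) (mg (n + 1 + K))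
    have h4 := Hf_comp_le μ ((mF n).prodMk ((mf (N + n)).prodMk (mg (n + 1 + K))))
      (fun w => ((fun j => if hj : (j : ℕ) < n then w.1 ⟨j, hj⟩ else w.2.1 : Fin (n+1) → ℕ), w.2.2))
    have h5 : Hf μ (fun x => (itin T f (n+1) (T^[N] x), itin T g (n + 1 + K) x)) ≤
      Hf μ (fun x => (itin T f n (T^[N] x), f (T^[N + n] x), itin T g (n + 1 + K) x)) := by
      refine le_trans (le_of_eq ?_) h4
      congr 1
      funext x
      simp only [Prod.mk.injEq, and_true]
      funext j
      by_cases hj : (j : ℕ) < n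
      · simp [hj, itin]
      · have : (j : ℕ) = n := by omega
        simp [itin, this, ← Function.iterate_add_apply, add_comm]
    rw [← ENNReal.add_le_add_iff_right hG]
    calc _ ≤ _ := add_le_add_left h5 _
      _ ≤ _ := h3
      _ ≤ _ := add_le_add h1 h2
      _ = _ := by push_cast; ring

lemma Hf_itin_le (μ : Measure X) [IsProbabilityMeasure μ] {T : X → X}
    (hT : MeasurePreserving T μ μ) {f g : X → ℕ} (hf : Measurable f) (hg : Measurable g)
    (hfin : Hf μ g ≠ ⊤) (N K : ℕ) (d : ℝ≥0∞)
    (h : Hf μ (fun x => (f (T^[N] x), itin T g K x)) ≤ Hf μ (itin T g K) + d) (n : ℕ) :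
    Hf μ (itin T f n) ≤ Hf μ (itin T g (n + K)) + n * d := by
  refine le_trans ?_ (Hf_joint_bound μ hT hf hg hfin N K d h n)
  have mF := itin_meas hT.measurable hf n
  rw [← Hf_comp_eq μ (hT.iterate N) mF]
  have mF' : Measurable (fun x => itin T f n (T^[N] x)) := mF.comp (hT.measurable.iterate N)
  exact Hf_comp_le μ (mF'.prodMk (itin_meas hT.measurable hg (n+K))) Prod.fst

lemma tendsto_ratio (m K : ℕ) (hm : 0 < m) (c : ℝ≥0∞) :
    Tendsto (fun n : ℕ => ENNReal.ofReal (((n + K : ℕ) : ℝ) / m + 1) * c / (n : ℝ≥0∞)) atTop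
      (nhds (c / m)) := by
  have h1 : Tendsto (fun n : ℕ => (1 : ℝ) / m + ((K : ℝ) / m + 1) / n) atTop (nhds (1 / m + 0)) :=
    tendsto_const_nhds.add (tendsto_const_div_atTop_nhds_zero_nat _)
  have h2 := ENNReal.tendsto_ofReal h1
  have e : ENNReal.ofReal ((1 : ℝ) / m + 0) = (m : ℝ≥0∞)⁻¹ := by
    rw [add_zero, one_div, ENNReal.ofReal_inv_of_pos (by exact_mod_cast hm), ENNReal.ofReal_natCast]
  rw [e] at h2
  have h3 : Tendsto (fun n : ℕ => ENNReal.ofReal ((1 : ℝ) / m + ((K : ℝ) / m + 1) / n) * c) atTop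
      (nhds ((m : ℝ≥0∞)⁻¹ * c)) := by
    refine ENNReal.Tendsto.mul_const h2 (Or.inl ?_)
    simp
  rw [div_eq_mul_inv, mul_comm]
  refine h3.congr' ?_
  filter_upwards [eventually_gt_atTop 0] with n hn
  have hn' : (0 : ℝ) < n := by exact_mod_cast hn
  rw [ENNReal.mul_div_right_comm]
  congr 1
  rw [← ENNReal.ofReal_natCast (n := n), ← ENNReal.ofReal_div_of_pos hn']
  congr 1
  have hm' : (0 : ℝ) < m := by exact_mod_cast hm
  push_cast
  field_simp
  try ring

/-- consequence: entropy bound -/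
lemma liminf_itin_le (μ : Measure X) [IsProbabilityMeasure μ] {T : X → X}
    (hT : MeasurePreserving T μ μ) {f g : X → ℕ} (hf : Measurable f) (hg : Measurable g)
    (hfin : Hf μ g ≠ ⊤)
    (h : ∀ d : ℝ≥0∞, 0 < d → ∃ N K : ℕ,
      Hf μ (fun x => (f (T^[N] x), itin T g K x)) ≤ Hf μ (itin T g K) + d)
    (m : ℕ) (hm : 0 < m) :
    atTop.liminf (fun n : ℕ => Hf μ (itin T f n) / (n : ℝ≥0∞)) ≤ Hf μ (itin T g m) / m := by
  apply le_of_forall_pos_le_add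
  intro d hd
  obtain ⟨N, K, hNK⟩ := h d hd
  have ht := (tendsto_ratio m K hm (Hf μ (itin T g m))).add (tendsto_const_nhds (x := d))
  rw [← ht.liminf_eq]
  refine liminf_le_liminf ?_
  filter_upwards [eventually_gt_atTop 0] with n hn
  have hn0 : (n : ℝ≥0∞) ≠ 0 := by exact_mod_cast hn.ne'
  have h1 := Hf_itin_le μ hT hf hg hfin N K d hNK n
  have h2 := Hf_itin_bound μ hT hg m (n + K) hm
  calc Hf μ (itin T f n) / (n : ℝ≥0∞)
      ≤ (ENNReal.ofReal (((n + K : ℕ) : ℝ) / m + 1) * Hf μ (itin T g m) + n * d) / n := by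
        gcongr; exact h1.trans (add_le_add_left h2 _)
    _ = _ := by
        rw [ENNReal.add_div, mul_comm (n : ℝ≥0∞) d, ENNReal.mul_div_cancel_right hn0 (ENNReal.natCast_ne_top n)]

section
variable {S : Type*} [Countable S] [MeasurableSpace S] [MeasurableSingletonClass S]

noncomputable def cterm {S : Type*} (μ : Measure X) (k : X → S) (A : Set X) : ℝ≥0∞ :=
  ∑' s, ENNReal.ofReal (μ.real (k ⁻¹' {s}) *
    Real.negMulLog (μ.real (k ⁻¹' {s} ∩ A) / μ.real (k ⁻¹' {s})))

lemma negMulLog_split {p q : ℝ} (hp : 0 ≤ p) (hpq : p ≤ q) :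
    Real.negMulLog p = p * (-Real.log q) + q * Real.negMulLog (p / q) := by
  rcases hp.eq_or_lt with rfl | hp
  · simp
  · have hq : 0 < q := by linarith
    simp only [Real.negMulLog]
    rw [Real.log_div hp.ne' hq.ne']
    field_simp
    ring

lemma ofReal_meas_mul (μ : Measure X) [IsFiniteMeasure μ] (A : Set X) (c : ℝ) :
    ENNReal.ofReal (μ.real A * c) = μ A * ENNReal.ofReal c := by
  rw [ENNReal.ofReal_mul measureReal_nonneg, ofReal_measureReal]

lemma Hf_pair_eq (μ : Measure X) [IsProbabilityMeasure μ] {f : X → ℕ} {k : X → S}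
    (hf : Measurable f) (hk : Measurable k) :
    Hf μ (fun x => (f x, k x)) = Hf μ k + ∑' i, cterm μ k (f ⁻¹' {i}) := by
  have h1 : Hf μ k = ∑' i : ℕ, ∑' s, ENNReal.ofReal (μ.real (k ⁻¹' {s} ∩ f ⁻¹' {i}) *
      (- Real.log (μ.real (k ⁻¹' {s})))) := by
    rw [ENNReal.tsum_comm]
    unfold Hf partEntropy
    congr 1 with s
    simp_rw [ofReal_meas_mul]
    rw [ENNReal.tsum_mul_right]
    have := tsum_fib μ hf (k ⁻¹' {s})
    simp_rw [inter_comm (k ⁻¹' {s})]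
    rw [this, ← ofReal_meas_mul, Real.negMulLog, Measure.real]
    congr 1; ring
  rw [h1, ← ENNReal.tsum_add]
  unfold Hf partEntropy
  rw [ENNReal.tsum_prod']
  congr 1 with i
  unfold cterm
  rw [← ENNReal.tsum_add]
  congr 1 with s
  have hle : μ.real (k ⁻¹' {s} ∩ f ⁻¹' {i}) ≤ μ.real (k ⁻¹' {s}) :=
    measureReal_mono inter_subset_left
  have e : (fun x => (f x, k x)) ⁻¹' {(i, s)} = k ⁻¹' {s} ∩ f ⁻¹' {i} := by
    ext x; simp [and_comm]
  beta_reduce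
  rw [e, ← ENNReal.ofReal_add]
  · rw [← negMulLog_split measureReal_nonneg hle]; rfl
  · apply mul_nonneg measureReal_nonneg
    have := Real.log_nonpos measureReal_nonneg (measureReal_le_one (μ := μ) (s := k ⁻¹' {s}))
    linarith
  · apply mul_nonneg measureReal_nonneg
    apply Real.negMulLog_nonneg
    · positivity
    · exact div_le_one_of_le₀ hle measureReal_nonneg

lemma negMulLog_tangent {t c : ℝ} (ht : 0 ≤ t) (hc : 0 < c) :
    Real.negMulLog t + t ≤ t * (- Real.log c) + c := by
  rcases ht.eq_or_lt with rfl | ht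
  · simp; exact hc.le
  · have := Real.log_le_sub_one_of_pos (div_pos hc ht)
    rw [Real.log_div hc.ne' ht.ne'] at this
    have h2 := mul_le_mul_of_nonneg_left this ht.le
    have h3 : t * (c / t - 1) = c - t := by field_simp
    rw [h3] at h2
    simp only [Real.negMulLog]
    linarith

lemma cterm_le (μ : Measure X) [IsProbabilityMeasure μ] {k : X → S}
    (hk : Measurable k) (A : Set X) :
    cterm μ k A ≤ ENNReal.ofReal (Real.negMulLog (μ A).toReal) := by
  by_cases hA : μ A = 0
  · have : cterm μ k A = 0 := by
      unfold cterm
      rw [ENNReal.tsum_eq_zero]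
      intro s
      have : μ.real (k ⁻¹' {s} ∩ A) = 0 := by
        rw [Measure.real, measure_mono_null inter_subset_right hA]; rfl
      simp [this]
    rw [this]; exact bot_le
  · set c := μ.real A with hc
    have c0 : 0 < c := ENNReal.toReal_pos hA (measure_ne_top _ _)
    have c1 : c ≤ 1 := measureReal_le_one
    have l0 : 0 ≤ - Real.log c := by have := Real.log_nonpos c0.le c1; linarith
    have hs1 : ∑' s, μ (k ⁻¹' {s} ∩ A) = μ A := tsum_fib μ hk A
    have hs2 : ∑' s, μ (k ⁻¹' {s}) = 1 := by simpa using tsum_fib μ hk univ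
    rw [← ENNReal.add_le_add_iff_right (measure_ne_top μ A)]
    have e : ENNReal.ofReal (Real.negMulLog (μ A).toReal) + μ A
      = ∑' s, (μ (k ⁻¹' {s} ∩ A) * ENNReal.ofReal (- Real.log c) +
          μ (k ⁻¹' {s}) * ENNReal.ofReal c) := by
      rw [ENNReal.tsum_add, ENNReal.tsum_mul_right, ENNReal.tsum_mul_right, hs1, hs2, one_mul,
        ← ofReal_meas_mul, hc, ofReal_measureReal, Real.negMulLog, Measure.real]
      congr 2; ring
    rw [e]
    conv_lhs => rw [← hs1]
    unfold cterm
    rw [← ENNReal.tsum_add]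
    refine ENNReal.tsum_le_tsum fun s => ?_
    have hle : μ.real (k ⁻¹' {s} ∩ A) ≤ μ.real (k ⁻¹' {s}) :=
      measureReal_mono inter_subset_left
    have hn : (0:ℝ) ≤ μ.real (k ⁻¹' {s} ∩ A) := measureReal_nonneg
    have hn' : (0:ℝ) ≤ μ.real (k ⁻¹' {s}) := measureReal_nonneg
    rw [← ofReal_meas_mul, ← ofReal_meas_mul, ← ofReal_measureReal (μ := μ) (s := k ⁻¹' {s} ∩ A)]
    rw [← ENNReal.ofReal_add, ← ENNReal.ofReal_add]
    · apply ENNReal.ofReal_le_ofReal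
      rcases hn'.eq_or_lt with h0 | h0
      · have : μ.real (k ⁻¹' {s} ∩ A) = 0 := by linarith
        rw [this, ← h0]; simp
      · have := mul_le_mul_of_nonneg_left (negMulLog_tangent (div_nonneg hn hn') c0) hn'
        have e2 : μ.real (k ⁻¹' {s}) * (μ.real (k ⁻¹' {s} ∩ A) / μ.real (k ⁻¹' {s}))
          = μ.real (k ⁻¹' {s} ∩ A) := by field_simp
        rw [mul_add, mul_add, e2, ← mul_assoc, e2] at this
        exact this
    · positivity
    · positivity
    · exact mul_nonneg hn' (Real.negMulLog_nonneg (div_nonneg hn hn') (div_le_one_of_le₀ hle hn'))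
    · exact hn

lemma cterm_small (μ : Measure X) [IsProbabilityMeasure μ] {k : X → S}
    (hk : Measurable k) {A : Set X} (hA : MeasurableSet A) (C : Set S) (K : ℝ) (hK : 0 ≤ K) :
    cterm μ k A ≤ ENNReal.ofReal (1 + K) * μ (symmDiff A (k ⁻¹' C)) + ENNReal.ofReal (Real.exp (-K)) := by
  set D := symmDiff A (k ⁻¹' C) with hD
  have hs1 : ∑' s, μ (k ⁻¹' {s} ∩ D) = μ D := tsum_fib μ hk D
  have hs2 : ∑' s, μ (k ⁻¹' {s}) = 1 := by simpa using tsum_fib μ hk univ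
  have e : ENNReal.ofReal (1 + K) * μ D + ENNReal.ofReal (Real.exp (-K))
      = ∑' s, (μ (k ⁻¹' {s} ∩ D) * ENNReal.ofReal (1 + K) +
          μ (k ⁻¹' {s}) * ENNReal.ofReal (Real.exp (-K))) := by
    rw [ENNReal.tsum_add, ENNReal.tsum_mul_right, ENNReal.tsum_mul_right, hs1, hs2, one_mul, mul_comm]
  rw [e]
  unfold cterm
  refine ENNReal.tsum_le_tsum fun s => ?_
  have hle : μ.real (k ⁻¹' {s} ∩ A) ≤ μ.real (k ⁻¹' {s}) :=
    measureReal_mono inter_subset_left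
  have hn : (0:ℝ) ≤ μ.real (k ⁻¹' {s} ∩ A) := measureReal_nonneg
  have hn' : (0:ℝ) ≤ μ.real (k ⁻¹' {s}) := measureReal_nonneg
  have hnD : (0:ℝ) ≤ μ.real (k ⁻¹' {s} ∩ D) := measureReal_nonneg
  have hexp := Real.exp_pos (-K)
  rw [← ofReal_meas_mul, ← ofReal_meas_mul, ← ENNReal.ofReal_add (by positivity) (by positivity)]
  apply ENNReal.ofReal_le_ofReal
  rcases hn'.eq_or_lt with h0 | h0
  · rw [← h0]; simp; positivity
  have e2 : μ.real (k ⁻¹' {s}) * (μ.real (k ⁻¹' {s} ∩ A) / μ.real (k ⁻¹' {s}))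
          = μ.real (k ⁻¹' {s} ∩ A) := by field_simp
  by_cases hsC : s ∈ C
  · have eD : k ⁻¹' {s} ∩ D = k ⁻¹' {s} \ A := by
      ext x
      simp only [hD, mem_inter_iff, mem_preimage, mem_singleton_iff, mem_symmDiff, Set.mem_sdiff]
      constructor
      · rintro ⟨rfl, h⟩; tauto
      · rintro ⟨rfl, h⟩; tauto
    have e3 : μ.real (k ⁻¹' {s} ∩ A) + μ.real (k ⁻¹' {s} ∩ D) = μ.real (k ⁻¹' {s}) := by
      rw [eD]; exact measureReal_inter_add_sdiff hA
    have := mul_le_mul_of_nonneg_left (negMulLog_tangent (div_nonneg hn hn') one_pos) hn'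
    rw [mul_add, mul_add, e2, ← mul_assoc, e2] at this
    simp only [Real.log_one, neg_zero, mul_zero, zero_add, mul_one] at this
    nlinarith [mul_nonneg hnD hK, mul_nonneg hn' hexp.le]
  · have eD : k ⁻¹' {s} ∩ D = k ⁻¹' {s} ∩ A := by
      ext x
      simp only [hD, mem_inter_iff, mem_preimage, mem_singleton_iff, mem_symmDiff]
      constructor
      · rintro ⟨rfl, h⟩; tauto
      · rintro ⟨rfl, h⟩; tauto
    rw [eD]
    have := mul_le_mul_of_nonneg_left (negMulLog_tangent (div_nonneg hn hn') hexp) hn'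
    rw [mul_add, mul_add, e2, ← mul_assoc, e2] at this
    simp only [Real.log_exp, neg_neg] at this
    linarith
end

lemma cond_small (μ : Measure X) [IsProbabilityMeasure μ] {S : ℕ → Type*} [∀ n, Countable (S n)]
    [∀ n, MeasurableSpace (S n)] [∀ n, MeasurableSingletonClass (S n)]
    {k : ∀ n, X → S n} (hk : ∀ n, Measurable (k n)) {f : X → ℕ} (hf : Measurable f)
    (hfin : Hf μ f ≠ ⊤)
    (happ : ∀ i, ∀ δ : ℝ≥0∞, 0 < δ → ∀ᶠ n in atTop, ∃ C : Set (S n),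
      μ (symmDiff (f ⁻¹' {i}) (k n ⁻¹' C)) ≤ δ) (d : ℝ≥0∞) (hd : 0 < d) :
    ∃ n, Hf μ (fun x => (f x, k n x)) ≤ Hf μ (k n) + d := by
  have hlim : ∀ i, Tendsto (fun n => cterm μ (k n) (f ⁻¹' {i})) atTop (nhds 0) := by
    intro i
    rw [ENNReal.tendsto_nhds_zero]
    intro e he
    have h1 : Tendsto (fun m : ℕ => ENNReal.ofReal (Real.exp (-(m:ℝ)))) atTop (nhds 0) := by
      rw [← ENNReal.ofReal_zero]
      apply ENNReal.tendsto_ofReal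
      exact Real.tendsto_exp_neg_atTop_nhds_zero.comp tendsto_natCast_atTop_atTop
    obtain ⟨m, hm⟩ := ((ENNReal.tendsto_nhds_zero.1 h1) (e/2) (ENNReal.half_pos he.ne')).exists
    have hδ : 0 < e / 2 / ENNReal.ofReal (1 + m) :=
      ENNReal.div_pos (ENNReal.half_pos he.ne').ne' ENNReal.ofReal_ne_top
    filter_upwards [happ i _ hδ] with n hn
    obtain ⟨C, hC⟩ := hn
    refine (cterm_small μ (hk n) (hf (measurableSet_singleton i)) C m (Nat.cast_nonneg m)).trans ?_
    calc _ ≤ ENNReal.ofReal (1 + m) * (e / 2 / ENNReal.ofReal (1 + m)) + e / 2 := by gcongr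
      _ ≤ e / 2 + e / 2 := by gcongr; exact ENNReal.mul_div_le
      _ = e := ENNReal.add_halves e
  have hT := tendsto_lintegral_of_dominated_convergence (μ := Measure.count)
    (F := fun n i => cterm μ (k n) (f ⁻¹' {i})) (f := fun _ => 0)
    (fun i => ENNReal.ofReal (Real.negMulLog (μ (f ⁻¹' {i})).toReal))
    (fun n => measurable_of_countable _) (fun n => Eventually.of_forall fun i => cterm_le μ (hk n) _)
    (by rw [lintegral_count]; exact hfin) (Eventually.of_forall hlim)
  simp only [lintegral_count, tsum_zero] at hT
  obtain ⟨n, hn⟩ := ((ENNReal.tendsto_nhds_zero.1 hT) d hd).exists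
  exact ⟨n, by rw [Hf_pair_eq μ hf (hk n)]; gcongr⟩

lemma exists_index {ξ : ℕ → Set X} (h : IsCountablePartition ξ) :
    ∃ g : X → ℕ, Measurable g ∧ ∀ i, ξ i = g ⁻¹' {i} := by
  obtain ⟨hm, hd, hu⟩ := h
  have hex : ∀ x, ∃ i, x ∈ ξ i := fun x => by
    have : x ∈ ⋃ i, ξ i := by rw [hu]; trivial
    simpa using this
  choose g hg using hex
  have hξ : ∀ i, ξ i = g ⁻¹' {i} := by
    intro i
    ext x
    simp only [mem_preimage, mem_singleton_iff]
    constructor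
    · intro hx
      by_contra hne
      exact Set.disjoint_left.1 (hd hne) (hg x) hx
    · rintro rfl; exact hg x
  exact ⟨g, measurable_to_countable' fun i => by rw [← hξ]; exact hm i, hξ⟩

lemma joinAtom_eq (T : X → X) {ξ : ℕ → Set X} {g : X → ℕ} (hg : ∀ i, ξ i = g ⁻¹' {i}) (k r : ℕ)
    (w : Fin r → ℕ) : joinAtom T ξ k r w = (fun x => itin T g r (T^[k] x)) ⁻¹' {w} := by
  ext x
  simp only [joinAtom, mem_iInter, hg, mem_preimage, mem_singleton_iff, funext_iff, itin]
  refine forall_congr' fun j => ?_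
  rw [add_comm, Function.iterate_add_apply]

lemma entropyOf_eq (μ : Measure X) {T : X → X} (hT : MeasurePreserving T μ μ)
    {ξ : ℕ → Set X} {g : X → ℕ} (hg : ∀ i, ξ i = g ⁻¹' {i}) (hgm : Measurable g) :
    entropyOf T μ ξ = atTop.liminf (fun n : ℕ => Hf μ (itin T g n) / (n : ℝ≥0∞)) := by
  unfold entropyOf
  congr 1 with n
  congr 1
  rw [← Hf_comp_eq μ (hT.iterate 1) (itin_meas hT.measurable hgm n)]
  unfold Hf
  congr 1
  funext w
  exact joinAtom_eq T hg 1 n w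

/-- two-sided window -/
def win (T : X ≃ᵐ X) (g : X → ℕ) (N : ℕ) (x : X) : Fin (2 * N + 1) → ℕ :=
  fun j => g ((T.toEquiv ^ (((j : ℕ) : ℤ) - (N : ℤ))) x)

lemma zpow_meas (T : X ≃ᵐ X) (i : ℤ) : Measurable (⇑(T.toEquiv ^ i)) := by
  have hn : ∀ n : ℕ, Measurable (⇑(T.toEquiv ^ n)) := fun n => by
    rw [Equiv.Perm.coe_pow]
    exact T.measurable.iterate n
  have hn' : ∀ n : ℕ, Measurable (⇑((T.toEquiv ^ n)⁻¹)) := fun n => by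
    rw [← inv_pow, Equiv.Perm.coe_pow]
    exact T.symm.measurable.iterate n
  cases i with
  | ofNat n => simpa using hn n
  | negSucc n => rw [zpow_negSucc]; exact hn' _

lemma win_meas (T : X ≃ᵐ X) {g : X → ℕ} (hg : Measurable g) (N : ℕ) : Measurable (win T g N) :=
  measurable_pi_lambda _ fun _ => hg.comp (zpow_meas T _)

lemma win_shift (T : X ≃ᵐ X) (g : X → ℕ) (N : ℕ) (x : X) :
    win T g N (T^[N] x) = itin T g (2 * N + 1) x := by
  funext j
  simp only [win, itin]
  have h : ∀ (n : ℕ) x, T^[n] x = (T.toEquiv ^ ((n : ℕ) : ℤ)) x := by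
    intro n x
    rw [zpow_natCast, Equiv.Perm.coe_pow]; rfl
  rw [h, h, ← Equiv.Perm.mul_apply, ← zpow_add]
  simp

lemma win_factor (T : X ≃ᵐ X) (g : X → ℕ) {N M : ℕ} (h : N ≤ M) (x : X) :
    win T g N x = (fun (w : Fin (2 * M + 1) → ℕ) (j : Fin (2 * N + 1)) =>
      w ⟨j + (M - N), by omega⟩) (win T g M x) := by
  funext j
  simp only [win]
  congr 3
  push_cast [h]
  ring

lemma win_approx (T : X ≃ᵐ X) (μ : Measure X) [IsProbabilityMeasure μ] {ξ : ℕ → Set X} {g : X → ℕ}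
    (hg : ∀ i, ξ i = g ⁻¹' {i}) (hgm : Measurable g) (hgen : IsGenerator T μ ξ)
    {A : Set X} (hA : MeasurableSet A) {δ : ℝ≥0∞} (hδ : 0 < δ) :
    ∀ᶠ n in atTop, ∃ C : Set (Fin (2 * n + 1) → ℕ), μ (symmDiff A (win T g n ⁻¹' C)) ≤ δ := by
  set R : Set (Set X) := {A | ∃ N, ∃ C : Set (Fin (2 * N + 1) → ℕ), A = win T g N ⁻¹' C} with hR
  have lift : ∀ N M, N ≤ M → ∀ C : Set (Fin (2 * N + 1) → ℕ), ∃ C' : Set (Fin (2 * M + 1) → ℕ),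
      win T g N ⁻¹' C = win T g M ⁻¹' C' := by
    intro N M h C
    refine ⟨(fun (w : Fin (2 * M + 1) → ℕ) (j : Fin (2 * N + 1)) => w ⟨j + (M - N), by omega⟩) ⁻¹' C, ?_⟩
    ext x
    simp only [mem_preimage]
    rw [win_factor T g h]
  have hring : IsSetRing R := by
    refine ⟨⟨0, ∅, by simp⟩, ?_, ?_⟩
    · rintro s t ⟨N, C, rfl⟩ ⟨M, D, rfl⟩
      obtain ⟨C', hC'⟩ := lift N (max N M) (le_max_left _ _) C
      obtain ⟨D', hD'⟩ := lift M (max N M) (le_max_right _ _) D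
      exact ⟨_, C' ∪ D', by rw [hC', hD']; rfl⟩
    · rintro s t ⟨N, C, rfl⟩ ⟨M, D, rfl⟩
      obtain ⟨C', hC'⟩ := lift N (max N M) (le_max_left _ _) C
      obtain ⟨D', hD'⟩ := lift M (max N M) (le_max_right _ _) D
      exact ⟨_, C' \ D', by rw [hC', hD']; rfl⟩
  have hle : MeasurableSpace.generateFrom R ≤ ‹MeasurableSpace X› := by
    apply MeasurableSpace.generateFrom_le
    rintro _ ⟨N, C, rfl⟩
    exact win_meas T hgm N (to_countable C).measurableSet
  obtain ⟨B, hB, hAB⟩ := hgen A hA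
  have hB' : MeasurableSet[MeasurableSpace.generateFrom R] B := by
    refine MeasurableSpace.generateFrom_mono ?_ B hB
    rintro _ ⟨i, j, rfl⟩
    refine ⟨i.natAbs, {w | w ⟨(i + i.natAbs).toNat, by omega⟩ = j}, ?_⟩
    ext x
    have e : (((i + i.natAbs).toNat : ℕ) : ℤ) - (i.natAbs : ℤ) = i := by omega
    simp only [hg, win, mem_preimage, mem_singleton_iff, mem_setOf_eq, e]
  obtain ⟨t, ⟨N, C, rfl⟩, ht⟩ := @exists_measure_symmDiff_lt_of_generateFrom_isSetRing X
    (MeasurableSpace.generateFrom R) (μ.trim hle) (isFiniteMeasure_trim hle) R hring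
    ⟨{univ}, countable_singleton _, by
      rintro _ rfl; exact ⟨0, univ, by simp⟩, by simp⟩ rfl B hB' δ hδ
  have ht' : μ (symmDiff (win T g N ⁻¹' C) B) < δ := (le_trim hle).trans_lt ht
  filter_upwards [eventually_ge_atTop N] with n hn
  obtain ⟨C', hC'⟩ := lift N n hn C
  refine ⟨C', ?_⟩
  rw [← hC']
  calc μ (symmDiff A (win T g N ⁻¹' C)) ≤ μ (symmDiff A B) + μ (symmDiff B (win T g N ⁻¹' C)) :=
        (measure_mono (symmDiff_triangle _ _ _)).trans (measure_union_le _ _)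
    _ ≤ 0 + δ := by rw [hAB, symmDiff_comm B]; gcongr
    _ = δ := zero_add _

/-- Kolmogorov-Sinai bound -/
lemma ksEntropy_le (T : X ≃ᵐ X) (μ : Measure X) [IsProbabilityMeasure μ]
    (hT : MeasurePreserving T μ μ) {ξ : ℕ → Set X} {g : X → ℕ}
    (hg : ∀ i, ξ i = g ⁻¹' {i}) (hgm : Measurable g) (hgen : IsGenerator T μ ξ)
    (hfin : Hf μ g ≠ ⊤) (m : ℕ) (hm : 0 < m) :
    ksEntropy T μ ≤ Hf μ (itin T g m) / m := by
  unfold ksEntropy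
  refine iSup_le fun η => iSup_le fun hη => iSup_le fun hηfin => ?_
  obtain ⟨f, hfm, hf⟩ := exists_index hη
  rw [entropyOf_eq μ hT hf hfm]
  refine liminf_itin_le μ hT hfm hgm hfin ?_ m hm
  intro d hd
  have hf' : Hf μ f ≠ ⊤ := by
    have : η = fun i => f ⁻¹' {i} := funext hf
    rw [this] at hηfin
    exact hηfin
  obtain ⟨N, hN⟩ := cond_small μ (win_meas T hgm) hfm hf'
    (fun i δ hδ => win_approx T μ hg hgm hgen (hfm (measurableSet_singleton i)) hδ) d hd
  refine ⟨N, 2 * N + 1, ?_⟩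
  rw [← Hf_comp_eq μ (hT.iterate N) (hfm.prodMk (win_meas T hgm N)),
    ← Hf_comp_eq μ (hT.iterate N) (win_meas T hgm N)] at hN
  simp only [win_shift] at hN
  exact hN

lemma Hf_compare {S : Type*} [Countable S] [MeasurableSpace S] [MeasurableSingletonClass S]
    (μ ν : Measure X) [IsProbabilityMeasure μ] [IsProbabilityMeasure ν] {f : X → S}
    (hf : Measurable f) {ε : ℝ} (h0 : 0 < ε) (h1 : ε < 1)
    (h : ∀ s, |μ.real (f ⁻¹' {s}) - ν.real (f ⁻¹' {s})| ≤ ε * ν.real (f ⁻¹' {s})) :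
    Hf ν f ≤ ENNReal.ofReal (1 - ε)⁻¹ * Hf μ f + ENNReal.ofReal (Real.log (1 + ε)) := by
  have hs2 : ∑' s, ν (f ⁻¹' {s}) = 1 := by simpa using tsum_fib ν hf univ
  have l0 : 0 ≤ Real.log (1 + ε) := Real.log_nonneg (by linarith)
  have e : ENNReal.ofReal (1 - ε)⁻¹ * Hf μ f + ENNReal.ofReal (Real.log (1 + ε))
    = ∑' s, (ENNReal.ofReal (1 - ε)⁻¹ * ENNReal.ofReal (Real.negMulLog (μ.real (f ⁻¹' {s})))
      + ν (f ⁻¹' {s}) * ENNReal.ofReal (Real.log (1 + ε))) := by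
    rw [ENNReal.tsum_add, ENNReal.tsum_mul_right, ENNReal.tsum_mul_left, hs2, one_mul]
    rfl
  rw [e]
  unfold Hf partEntropy
  refine ENNReal.tsum_le_tsum fun s => ?_
  have hi : 0 < (1 - ε)⁻¹ := inv_pos.2 (by linarith)
  set p := μ.real (f ⁻¹' {s}) with hp
  have p0 : 0 ≤ p := measureReal_nonneg
  have p1 : p ≤ 1 := measureReal_le_one
  rw [← ofReal_meas_mul]
  have hsq := h s
  rw [← hp] at hsq
  change ENNReal.ofReal (Real.negMulLog (ν.real (f ⁻¹' {s}))) ≤ _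
  set q := ν.real (f ⁻¹' {s}) with hq
  have q0 : 0 ≤ q := measureReal_nonneg
  rw [← ENNReal.ofReal_mul hi.le, ← ENNReal.ofReal_add
    (mul_nonneg hi.le (Real.negMulLog_nonneg p0 p1)) (by positivity)]
  apply ENNReal.ofReal_le_ofReal
  obtain ⟨ha, hb⟩ := abs_le.1 hsq
  rcases q0.eq_or_lt with hz | hz
  · have : p = 0 := by rw [← hz] at ha hb; linarith
    rw [this, ← hz]; simp
  · have hpq : (1 - ε) * q ≤ p := by linarith
    have pp : 0 < p := lt_of_lt_of_le (mul_pos (by linarith) hz) hpq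
    have hq' : q ≤ (1 - ε)⁻¹ * p := by
      rw [inv_mul_eq_div, le_div_iff₀ (by linarith)]; linarith
    have hl : Real.log p ≤ Real.log (1 + ε) + Real.log q := by
      rw [← Real.log_mul (by linarith) hz.ne']
      exact Real.log_le_log pp (by linarith)
    have hlp : 0 ≤ - Real.log p := by have := Real.log_nonpos p0 p1; linarith
    have h2 := mul_le_mul_of_nonneg_right hq' hlp
    have h3 := mul_le_mul_of_nonneg_left hl hz.le
    simp only [Real.negMulLog]
    linarith

end Helpers

/-- **Main Theorem.** Let `T` be an automorphism of `(X, 𝓕)`, and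
let `μ 0, μ 1, μ 2, …` be `T`-invariant probability measures. Let `ξ` be a
countable measurable partition with `H_{μ 0}(ξ) < ∞` which is a generator for
every `(T, μ n)`. Suppose `r n → ∞`, `ε n → 0` with `ε n > 0`,
`limsup_n h_{μ n}(T) ≥ h`, and
`|μ 0 (A) - μ n (A)| ≤ ε n * μ n (A)` for every atom `A` of `⋁_{i=0}^{r n} T⁻ⁱ ξ`
and every `n`. Then `h_{μ 0}(T) ≥ h`. -/
theorem ksEntropy_ge_of_approx {X : Type*} [MeasurableSpace X] (T : X ≃ᵐ X)
    (μ : ℕ → Measure X) (hprob : ∀ n, IsProbabilityMeasure (μ n))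
    (hinv : ∀ n, MeasurePreserving T (μ n) (μ n))
    (ξ : ℕ → Set X) (hpart : IsCountablePartition ξ)
    (hfin : partEntropy (μ 0) ξ ≠ ⊤)
    (r : ℕ → ℕ) (ε : ℕ → ℝ) (hεpos : ∀ n, 0 < ε n)
    (hr : Tendsto r atTop atTop) (hε : Tendsto ε atTop (nhds 0))
    (h : ℝ≥0∞)
    (hlim : h ≤ Filter.atTop.limsup (fun n => ksEntropy T (μ n)))
    (hgen : ∀ n, IsGenerator T (μ n) ξ)
    (hclose : ∀ n, ∀ f : Fin (r n + 1) → ℕ,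
      |((μ 0) (joinAtom T ξ 0 (r n + 1) f)).toReal
          - ((μ n) (joinAtom T ξ 0 (r n + 1) f)).toReal|
        ≤ ε n * ((μ n) (joinAtom T ξ 0 (r n + 1) f)).toReal) :
    h ≤ ksEntropy T (μ 0) := by
  haveI := hprob
  obtain ⟨g, hgm, hg⟩ := exists_index hpart
  have hg0 : Hf (μ 0) g ≠ ⊤ := by
    have e : ξ = fun i => g ⁻¹' {i} := funext hg
    rw [e] at hfin
    exact hfin
  have key : ∀ m : ℕ, 0 < m → h ≤ Hf (μ 0) (itin T g m) / m := by
    intro m hm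
    refine hlim.trans ?_
    have hr1 : Tendsto (fun n => r n + 1) atTop atTop :=
      (tendsto_add_atTop_nat 1).comp hr
    have t1 := (tendsto_ratio m 0 hm (Hf (μ 0) (itin T g m))).comp hr1
    have t2 : Tendsto (fun n => ENNReal.ofReal (1 - ε n)⁻¹) atTop (nhds 1) := by
      have : Tendsto (fun n => (1 - ε n)⁻¹) atTop (nhds (1 - 0)⁻¹) :=
        (tendsto_const_nhds.sub hε).inv₀ (by norm_num)
      simpa using ENNReal.tendsto_ofReal this
    have t3 : Tendsto (fun n => ENNReal.ofReal (Real.log (1 + ε n))) atTop (nhds 0) := by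
      have : Tendsto (fun n => Real.log (1 + ε n)) atTop (nhds (Real.log (1 + 0))) :=
        (tendsto_const_nhds.add hε).log (by norm_num)
      simpa using ENNReal.tendsto_ofReal this
    have hc : Hf (μ 0) (itin T g m) / m ≠ ⊤ :=
      ENNReal.div_ne_top (Hf_itin_fin (μ 0) (hinv 0) hgm hg0 m) (by exact_mod_cast hm.ne')
    have t4 := (ENNReal.Tendsto.mul t2 (Or.inl one_ne_zero) t1 (Or.inr ENNReal.one_ne_top)).add t3
    rw [one_mul, add_zero] at t4
    rw [← t4.limsup_eq]
    refine limsup_le_limsup ?_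
    have hε1 : ∀ᶠ n in atTop, ε n < 1 := hε.eventually (gt_mem_nhds one_pos)
    filter_upwards [hε1] with n hn
    have hcmp := Hf_compare (μ 0) (μ n) (itin_meas T.measurable hgm (r n + 1)) (hεpos n) hn (by
      intro w
      have := hclose n w
      rw [joinAtom_eq T hg] at this
      exact this)
    have hfn : Hf (μ n) g ≠ ⊤ := by
      refine ne_top_of_le_ne_top ?_ ((Hf_itin_one' (μ n) T.measurable hgm).trans
        ((Hf_itin_mono (μ n) T.measurable hgm (Nat.le_add_left 1 (r n))).trans hcmp))
      exact ENNReal.add_ne_top.2 ⟨ENNReal.mul_ne_top ENNReal.ofReal_ne_top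
        (Hf_itin_fin (μ 0) (hinv 0) hgm hg0 _), ENNReal.ofReal_ne_top⟩
    refine (ksEntropy_le T (μ n) (hinv n) hg hgm (hgen n) hfn (r n + 1) (Nat.succ_pos _)).trans ?_
    have hb := Hf_itin_bound (μ 0) (hinv 0) hgm m (r n + 1) hm
    refine (ENNReal.div_le_div_right hcmp _).trans ?_
    rw [ENNReal.add_div]
    refine add_le_add ?_ ?_
    · rw [mul_div_assoc]
      refine mul_le_mul_right (ENNReal.div_le_div_right hb _) _
    · refine ENNReal.div_le_of_le_mul ?_
      refine le_mul_of_one_le_right bot_le ?_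
      exact_mod_cast Nat.succ_le_succ (Nat.zero_le (r n))
  refine le_trans ?_ (le_iSup_of_le ξ (le_iSup_of_le hpart (le_iSup_of_le hfin le_rfl)))
  rw [entropyOf_eq (μ 0) (hinv 0) hg hgm]
  refine le_liminf_of_le (by isBoundedDefault) ?_
  filter_upwards [eventually_gt_atTop 0] with m hm
  exact key m hm
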